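/- An orientation preserving circle homeomorphism f is strongly reversible in Homeo⁺(S¹) if and only if either f is an involution, or f has a fixed point and there exists an orientation preserving homeomorphism h of rotation number 1/2 with Δ_f = −Δ_f ∘ h. -/

import Mathlib

noncomputable section

open scoped Classical

local instance : Fact ((0:ℝ) < 1) := ⟨zero_lt_one⟩

/-- The circle `S¹`, realised as `ℝ / ℤ`. -/
abbrev S1 := AddCircle (1 : ℝ)

/-- `F` is a (monotone, degree one) lift of the circle homeomorphism `f`. -/
def IsLiftOf (f : S1 ≃ₜ S1) (F : CircleDeg1Lift) : Prop :=
  ∀ x : ℝ, f (x : S1) = ((F x : ℝ) : S1)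

/-- A circle homeomorphism is orientation preserving iff it admits a monotone degree one lift. -/
def OrientationPreserving (f : S1 ≃ₜ S1) : Prop :=
  ∃ F : CircleDeg1Lift, IsLiftOf f F

/-- A circle homeomorphism is orientation reversing iff it admits a strictly decreasing
degree `-1` lift. -/
def OrientationReversing (f : S1 ≃ₜ S1) : Prop :=
  ∃ F : ℝ → ℝ, StrictAnti F ∧ (∀ x : ℝ, F (x + 1) = F x - 1) ∧
    ∀ x : ℝ, f (x : S1) = ((F x : ℝ) : S1)

/-- `f` has (Poincaré) rotation number `r` (mod 1): some lift has translation number `r`. -/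
def HasRotationNumber (f : S1 ≃ₜ S1) (r : ℝ) : Prop :=
  ∃ F : CircleDeg1Lift, IsLiftOf f F ∧ F.translationNumber = r

/-- An involution. -/
def IsInvolution (f : S1 ≃ₜ S1) : Prop := ∀ x, f (f x) = x

/-- The canonical representative of a point of the circle in `[0, 1)`. -/
def rep (x : S1) : ℝ := (AddCircle.equivIco 1 0 x : ℝ)

/-- The signature of a circle homeomorphism with respect to a lift `F`; when `F` is the
(unique) lift with a fixed point of an orientation preserving homeomorphism with a fixed
point, this is the signature function `Δ_f : S¹ → {-1, 0, 1}`. -/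
def signature (F : CircleDeg1Lift) (x : S1) : ℝ := Real.sign (F (rep x) - rep x)

/-- Strong reversibility in `Homeo⁺(S¹)`. -/
def StronglyReversiblePlus (f : S1 ≃ₜ S1) : Prop :=
  ∃ σ : S1 ≃ₜ S1, OrientationPreserving σ ∧ IsInvolution σ ∧ ∀ x, σ (f (σ x)) = f.symm x

/-- Strong reversibility in the full group `Homeo(S¹)`. -/
def StronglyReversible (f : S1 ≃ₜ S1) : Prop :=
  ∃ τ : S1 ≃ₜ S1, IsInvolution τ ∧ ∀ x, τ (f (τ x)) = f.symm x

/-! ### Conjugating order isomorphisms of the line with the same fixed points -/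

/-- Two reals are equivalent if they are equal or not separated by a point of `P`. -/
def unseparatedSetoid (P : Set ℝ) : Setoid ℝ where
  r x y := x = y ∨ Disjoint (Set.uIcc x y) P
  iseqv :=
    { refl := fun _ => Or.inl rfl
      symm := by
        rintro x y (h | h)
        · exact Or.inl h.symm
        · exact Or.inr (Set.uIcc_comm x y ▸ h)
      trans := by
        rintro x y z (rfl | h) (rfl | h')
        · exact Or.inl rfl
        · exact Or.inr h'
        · exact Or.inr h
        · exact Or.inr ((h.union_left h').mono_left Set.uIcc_subset_uIcc_union_uIcc) }

/-- A chosen representative of the class of `x` for `unseparatedSetoid P`. -/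
def basePoint (P : Set ℝ) (x : ℝ) : ℝ := (Quotient.mk (unseparatedSetoid P) x).out

theorem basePoint_rel (P : Set ℝ) (x : ℝ) :
    basePoint P x = x ∨ Disjoint (Set.uIcc (basePoint P x) x) P :=
  Quotient.exact (s := unseparatedSetoid P) (Quotient.out_eq _)

theorem basePoint_eq {P : Set ℝ} {x y : ℝ} (h : x = y ∨ Disjoint (Set.uIcc x y) P) :
    basePoint P x = basePoint P y :=
  congrArg Quotient.out (Quotient.sound (s := unseparatedSetoid P) h)

theorem basePoint_of_mem {P : Set ℝ} {x : ℝ} (hx : x ∈ P) : basePoint P x = x :=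
  (basePoint_rel P x).resolve_right fun h => Set.disjoint_left.1 h Set.right_mem_uIcc hx

theorem disjoint_uIcc_basePoint {P : Set ℝ} {x : ℝ} (hx : x ∉ P) :
    Disjoint (Set.uIcc (basePoint P x) x) P := by
  rcases basePoint_rel P x with h | h
  · rw [h, Set.uIcc_self]
    exact Set.disjoint_singleton_left.2 hx
  · exact h

theorem zpow_apply_of_fixed {A : ℝ ≃o ℝ} {z : ℝ} (hz : A z = z) (n : ℤ) : (A ^ n) z = z := by
  induction n with
  | zero => rfl
  | succ n ih => rw [zpow_add_one, RelIso.mul_apply, hz, ih]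
  | pred n ih =>
    have h : A⁻¹ z = z := A.injective (by rw [RelIso.apply_inv_self, hz])
    rw [zpow_sub_one, RelIso.mul_apply, h, ih]

theorem strictMono_zpow_apply {A : ℝ ≃o ℝ} {r : ℝ} (hr : r < A r) :
    StrictMono fun n : ℤ => (A ^ n) r :=
  strictMono_int_of_lt_succ fun n => by
    rw [zpow_add_one, RelIso.mul_apply]
    exact (A ^ n).strictMono hr

theorem exists_lt_zpow_apply {A : ℝ ≃o ℝ} {r x : ℝ} (hr : r < A r)
    (h : ∀ z ∈ Set.Icc r x, A z ≠ z) : ∃ n : ℕ, x < (A ^ (n : ℤ)) r := by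
  by_contra! hx
  set u : ℕ → ℝ := fun n => (A ^ (n : ℤ)) r
  have hbdd : BddAbove (Set.range u) := ⟨x, Set.forall_mem_range.2 hx⟩
  have hmono : Monotone u := fun m n hmn =>
    (strictMono_zpow_apply hr).monotone (Int.ofNat_le.2 hmn)
  refine h (⨆ n, u n) ⟨le_ciSup hbdd 0, ciSup_le hx⟩ ?_
  have hsucc : ∀ n, A (u n) = u (n + 1) := fun n => by
    simp only [u]
    rw [Nat.cast_succ, add_comm, zpow_add, zpow_one, RelIso.mul_apply]
  rw [A.map_ciSup hbdd]
  simp only [hsucc]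
  exact tendsto_nhds_unique
    (tendsto_atTop_ciSup (fun m n hmn => hmono (Nat.succ_le_succ hmn))
      ⟨x, Set.forall_mem_range.2 fun n => hx (n + 1)⟩)
    ((tendsto_atTop_ciSup hmono hbdd).comp (Filter.tendsto_add_atTop_nat 1))

/-- The orbit chart of `A` at `r`: it conjugates the unit translation to `A`. -/
def orbitChart (A : ℝ ≃o ℝ) (r t : ℝ) : ℝ := (A ^ ⌊t⌋) (r + Int.fract t * (A r - r))

theorem orbitChart_add_one (A : ℝ ≃o ℝ) (r t : ℝ) :
    orbitChart A r (t + 1) = A (orbitChart A r t) := by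
  rw [orbitChart, orbitChart, Int.floor_add_one, Int.fract_add_one, add_comm, zpow_add, zpow_one,
    RelIso.mul_apply]

theorem orbitChart_of_fixed {A : ℝ ≃o ℝ} {r : ℝ} (hr : A r = r) (t : ℝ) :
    orbitChart A r t = r := by
  rw [orbitChart, hr, sub_self, mul_zero, add_zero, zpow_apply_of_fixed hr]

theorem zpow_floor_le_orbitChart {A : ℝ ≃o ℝ} {r : ℝ} (hr : r < A r) (t : ℝ) :
    (A ^ ⌊t⌋) r ≤ orbitChart A r t :=
  (A ^ ⌊t⌋).monotone
    (le_add_of_nonneg_right (mul_nonneg (Int.fract_nonneg t) (sub_nonneg.2 hr.le)))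

theorem orbitChart_lt_zpow_floor_add_one {A : ℝ ≃o ℝ} {r : ℝ} (hr : r < A r) (t : ℝ) :
    orbitChart A r t < (A ^ (⌊t⌋ + 1)) r := by
  rw [zpow_add_one, RelIso.mul_apply]
  refine (A ^ ⌊t⌋).strictMono ?_
  nlinarith [Int.fract_lt_one t, sub_pos.2 hr]

theorem strictMono_orbitChart {A : ℝ ≃o ℝ} {r : ℝ} (hr : r < A r) :
    StrictMono (orbitChart A r) := by
  intro s t hst
  rcases (Int.floor_mono hst.le).eq_or_lt with h | h
  · rw [orbitChart, orbitChart, h]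
    refine (A ^ ⌊t⌋).strictMono ?_
    have : Int.fract s < Int.fract t := by
      rw [Int.fract, Int.fract, h]
      linarith
    nlinarith [sub_pos.2 hr]
  · calc orbitChart A r s < (A ^ (⌊s⌋ + 1)) r := orbitChart_lt_zpow_floor_add_one hr s
      _ ≤ (A ^ ⌊t⌋) r := (strictMono_zpow_apply hr).monotone (Int.add_one_le_iff.2 h)
      _ ≤ orbitChart A r t := zpow_floor_le_orbitChart hr t

theorem disjoint_uIcc_orbitChart {A : ℝ ≃o ℝ} {r : ℝ} (hr : r < A r) (t : ℝ) :
    Disjoint (Set.uIcc r (orbitChart A r t)) {z | A z = z} := by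
  refine Set.disjoint_left.2 fun z hz hfix => ?_
  have hzA : ∀ n : ℤ, (A ^ n) z = z := zpow_apply_of_fixed hfix
  have h₁ := zpow_floor_le_orbitChart hr t
  have h₂ := orbitChart_lt_zpow_floor_add_one hr t
  rcases lt_trichotomy z r with h | rfl | h
  · have := (A ^ ⌊t⌋).strictMono h
    rw [hzA] at this
    rcases Set.mem_uIcc.1 hz with hz | hz <;> linarith [hz.1, hz.2]
  · exact hr.ne' hfix
  · have := (A ^ (⌊t⌋ + 1)).strictMono h
    rw [hzA] at this
    rcases Set.mem_uIcc.1 hz with hz | hz <;> linarith [hz.1, hz.2]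

theorem exists_orbitChart_eq {A : ℝ ≃o ℝ} (hA : ∀ z, z ≤ A z) {r x : ℝ}
    (h : Disjoint (Set.uIcc r x) {z | A z = z}) : ∃ t, orbitChart A r t = x := by
  have hne : ∀ z ∈ Set.uIcc r x, A z ≠ z := fun z hz => Set.disjoint_left.1 h hz
  have hr : r < A r := (hA r).lt_of_ne (hne r Set.left_mem_uIcc).symm
  have hx : x < A x := (hA x).lt_of_ne (hne x Set.right_mem_uIcc).symm
  obtain ⟨n, hn⟩ := exists_lt_zpow_apply hr fun z hz => hne z (Set.Icc_subset_uIcc hz)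
  obtain ⟨m, hm⟩ := exists_lt_zpow_apply hx fun z hz => hne z (Set.Icc_subset_uIcc' hz)
  obtain ⟨k, hk, hmax⟩ := Int.exists_greatest_of_bdd (P := fun k : ℤ => (A ^ k) r ≤ x)
    ⟨n, fun k hk => (strictMono_zpow_apply hr).le_iff_le.1 (hk.trans hn.le)⟩
    ⟨-m, by
      have := (A ^ (-(m : ℤ))).monotone hm.le
      rwa [← RelIso.mul_apply, ← zpow_add, neg_add_cancel] at this⟩
  have hk' : x < (A ^ (k + 1)) r := by
    by_contra! hc
    linarith [hmax _ hc]
  obtain ⟨y, rfl⟩ := (A ^ k).surjective x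
  rw [zpow_add_one, RelIso.mul_apply] at hk'
  have hy₁ : r ≤ y := (A ^ k).le_iff_le.1 hk
  have hy₂ : y < A r := (A ^ k).lt_iff_lt.1 hk'
  have hd : 0 < A r - r := sub_pos.2 hr
  have hq : (y - r) / (A r - r) ∈ Set.Ico (0 : ℝ) 1 :=
    ⟨div_nonneg (sub_nonneg.2 hy₁) hd.le, (div_lt_one hd).2 (by linarith)⟩
  refine ⟨k + (y - r) / (A r - r), ?_⟩
  rw [orbitChart, Int.floor_intCast_add, Int.fract_intCast_add, Int.floor_eq_zero_iff.2 hq,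
    Int.fract_eq_self.2 hq, add_zero, div_mul_cancel₀ _ hd.ne', add_sub_cancel]

/-- Transport along orbit charts: it carries the dynamics of `A` to that of `B`. -/
def chartTransport (A B : ℝ ≃o ℝ) (x : ℝ) : ℝ :=
  orbitChart B (basePoint {z | A z = z} x)
    (Function.invFun (orbitChart A (basePoint {z | A z = z} x)) x)

theorem chartTransport_of_fixed {A B : ℝ ≃o ℝ} {x : ℝ} (hA : A x = x) (hB : B x = x) :
    chartTransport A B x = x := by
  have : basePoint {z | A z = z} x = x := basePoint_of_mem hA
  rw [chartTransport, this, orbitChart_of_fixed hB]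

theorem lt_basePoint {A : ℝ ≃o ℝ} (hA : ∀ z, z ≤ A z) {x : ℝ} (hx : A x ≠ x) :
    basePoint {z | A z = z} x < A (basePoint {z | A z = z} x) :=
  (hA _).lt_of_ne fun h =>
    Set.disjoint_left.1 (disjoint_uIcc_basePoint (P := {z | A z = z}) hx) Set.left_mem_uIcc h.symm

theorem exists_orbitChart_basePoint_eq {A : ℝ ≃o ℝ} (hA : ∀ z, z ≤ A z) {x : ℝ} (hx : A x ≠ x) :
    ∃ t, orbitChart A (basePoint {z | A z = z} x) t = x :=
  exists_orbitChart_eq hA (disjoint_uIcc_basePoint (P := {z | A z = z}) hx)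

theorem basePoint_orbitChart {A : ℝ ≃o ℝ} (hA : ∀ z, z ≤ A z) {x : ℝ} (hx : A x ≠ x) (t : ℝ) :
    basePoint {z | A z = z} (orbitChart A (basePoint {z | A z = z} x) t) =
      basePoint {z | A z = z} x := by
  rw [← basePoint_eq (Or.inr (disjoint_uIcc_orbitChart (lt_basePoint hA hx) t)),
    basePoint_eq (basePoint_rel _ x)]

theorem chartTransport_orbitChart {A : ℝ ≃o ℝ} (hA : ∀ z, z ≤ A z) (B : ℝ ≃o ℝ) {x : ℝ}
    (hx : A x ≠ x) (t : ℝ) :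
    chartTransport A B (orbitChart A (basePoint {z | A z = z} x) t) =
      orbitChart B (basePoint {z | A z = z} x) t := by
  rw [chartTransport, basePoint_orbitChart hA hx,
    Function.leftInverse_invFun (strictMono_orbitChart (lt_basePoint hA hx)).injective]

theorem chartTransport_semiconj {A B : ℝ ≃o ℝ} (hA : ∀ z, z ≤ A z)
    (hAB : ∀ z, A z = z ↔ B z = z) (x : ℝ) :
    chartTransport A B (A x) = B (chartTransport A B x) := by
  by_cases hx : A x = x
  · rw [hx, chartTransport_of_fixed hx ((hAB x).1 hx), (hAB x).1 hx]
  · obtain ⟨t, ht⟩ := exists_orbitChart_basePoint_eq hA hx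
    conv_lhs => rw [← ht]
    conv_rhs => rw [← ht]
    rw [← orbitChart_add_one, chartTransport_orbitChart hA B hx, chartTransport_orbitChart hA B hx,
      orbitChart_add_one]

theorem chartTransport_leftInverse {A B : ℝ ≃o ℝ} (hA : ∀ z, z ≤ A z) (hB : ∀ z, z ≤ B z)
    (hAB : ∀ z, A z = z ↔ B z = z) :
    Function.LeftInverse (chartTransport B A) (chartTransport A B) := by
  intro x
  by_cases hx : A x = x
  · rw [chartTransport_of_fixed hx ((hAB x).1 hx), chartTransport_of_fixed ((hAB x).1 hx) hx]
  · have hP : {z | A z = z} = {z | B z = z} := Set.ext hAB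
    obtain ⟨t, ht⟩ := exists_orbitChart_basePoint_eq hA hx
    conv_lhs => rw [← ht]
    rw [chartTransport_orbitChart hA B hx, hP,
      chartTransport_orbitChart hB A (fun h => hx ((hAB x).2 h)), ← hP, ht]

theorem chartTransport_rel {A B : ℝ ≃o ℝ} (hB : ∀ z, z ≤ B z)
    (hAB : ∀ z, A z = z ↔ B z = z) (x : ℝ) :
    x = chartTransport A B x ∨ Disjoint (Set.uIcc x (chartTransport A B x)) {z | A z = z} := by
  by_cases hx : A x = x
  · exact Or.inl (chartTransport_of_fixed hx ((hAB x).1 hx)).symm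
  · have hP : {z | A z = z} = {z | B z = z} := Set.ext hAB
    have h₁ := disjoint_uIcc_basePoint (P := {z | A z = z}) hx
    have h₂ : Disjoint (Set.uIcc (basePoint {z | A z = z} x) (chartTransport A B x))
        {z | A z = z} := by
      have hlt := lt_basePoint hB (fun h => hx ((hAB x).2 h))
      rw [← hP] at hlt
      rw [chartTransport]
      convert disjoint_uIcc_orbitChart hlt _ using 1
    rw [Set.uIcc_comm] at h₁
    exact Or.inr ((h₁.union_left h₂).mono_left Set.uIcc_subset_uIcc_union_uIcc)

theorem strictMono_chartTransport {A B : ℝ ≃o ℝ} (hA : ∀ z, z ≤ A z) (hB : ∀ z, z ≤ B z)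
    (hAB : ∀ z, A z = z ↔ B z = z) : StrictMono (chartTransport A B) := by
  intro x y hxy
  by_cases h : Disjoint (Set.uIcc x y) {z | A z = z}
  · have hx : A x ≠ x := Set.disjoint_left.1 h Set.left_mem_uIcc
    have hy : A y ≠ y := Set.disjoint_left.1 h Set.right_mem_uIcc
    have hxy' := basePoint_eq (Or.inr h)
    obtain ⟨s, hs⟩ := exists_orbitChart_basePoint_eq hA hx
    obtain ⟨t, ht⟩ := exists_orbitChart_basePoint_eq hA hy
    rw [← hxy'] at ht
    have hst : s < t :=
      (strictMono_orbitChart (lt_basePoint hA hx)).lt_iff_lt.1 (by rwa [hs, ht])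
    have hP : {z | A z = z} = {z | B z = z} := Set.ext hAB
    have hlt := lt_basePoint hB (fun h => hx ((hAB x).2 h))
    rw [← hP] at hlt
    rw [← hs, ← ht, chartTransport_orbitChart hA B hx, chartTransport_orbitChart hA B hx]
    exact strictMono_orbitChart hlt hst
  · obtain ⟨p, hp, hpA⟩ := Set.not_disjoint_iff.1 h
    rw [Set.uIcc_of_le hxy.le] at hp
    refine lt_of_le_of_ne ?_ ((chartTransport_leftInverse hA hB hAB).injective.ne hxy.ne)
    have h₁ : chartTransport A B x ≤ p := by
      rcases chartTransport_rel hB hAB x with h | h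
      · exact h ▸ hp.1
      · by_contra! hc
        exact Set.disjoint_left.1 h (Set.Icc_subset_uIcc ⟨hp.1, hc.le⟩) hpA
    have h₂ : p ≤ chartTransport A B y := by
      rcases chartTransport_rel hB hAB y with h | h
      · exact h ▸ hp.2
      · by_contra! hc
        exact Set.disjoint_left.1 h (Set.Icc_subset_uIcc' ⟨hc.le, hp.2⟩) hpA
    exact h₁.trans h₂

theorem exists_orderIso_max_symm (A : ℝ ≃o ℝ) :
    ∃ C : ℝ ≃o ℝ, ∀ x, C x = max (A x) (A.symm x) := by
  have hmono : StrictMono fun x => max (A x) (A.symm x) := fun x y h =>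
    max_lt_max (A.strictMono h) (A.symm.strictMono h)
  refine ⟨hmono.orderIsoOfSurjective _ fun x => ⟨min (A x) (A.symm x), ?_⟩, fun x => rfl⟩
  rcases le_total x (A x) with h | h
  · have h' : A.symm x ≤ x := A.symm_apply_le.2 h
    have h'' : A.symm (A.symm x) ≤ x := (A.symm.monotone h').trans h'
    simp [min_eq_right (h'.trans h), h'']
  · have h' : x ≤ A.symm x := A.le_symm_apply.2 h
    have h'' : A (A x) ≤ x := (A.monotone h).trans h
    simp [min_eq_left (h.trans h'), h'']

theorem exists_conjugacy_of_le {A B : ℝ ≃o ℝ} (hA : ∀ z, z ≤ A z) (hB : ∀ z, z ≤ B z)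
    (hAB : ∀ z, A z = z ↔ B z = z) :
    ∃ k : ℝ ≃o ℝ, (∀ x, k (A x) = B (k x)) ∧
      ∀ x, x = k x ∨ Disjoint (Set.uIcc x (k x)) {z | A z = z} := by
  have hsurj : Function.Surjective (chartTransport A B) :=
    (chartTransport_leftInverse hB hA fun z => (hAB z).symm).surjective
  refine ⟨(strictMono_chartTransport hA hB hAB).orderIsoOfSurjective _ hsurj, ?_⟩
  simp only [StrictMono.coe_orderIsoOfSurjective]
  exact ⟨chartTransport_semiconj hA hAB, chartTransport_rel hB hAB⟩

theorem le_max_symm (C : ℝ ≃o ℝ) (x : ℝ) : x ≤ max (C x) (C.symm x) := by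
  rcases le_total x (C x) with h | h
  · exact le_max_of_le_left h
  · exact le_max_of_le_right (C.le_symm_apply.2 h)

theorem max_symm_eq_self_iff (C : ℝ ≃o ℝ) (x : ℝ) : max (C x) (C.symm x) = x ↔ C x = x := by
  refine ⟨fun h => ?_, fun h => by rw [h, C.symm_apply_eq.2 h.symm, max_self]⟩
  have h₁ : C x ≤ x := (le_max_left _ _).trans h.le
  have h₂ : C.symm x ≤ x := (le_max_right _ _).trans h.le
  exact h₁.antisymm (C.symm_apply_le.1 h₂)

theorem max_symm_of_lt {C : ℝ ≃o ℝ} {x : ℝ} (h : x < C x) : max (C x) (C.symm x) = C x :=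
  max_eq_left ((C.symm_apply_le.2 h.le).trans h.le)

theorem max_symm_of_gt {C : ℝ ≃o ℝ} {x : ℝ} (h : C x < x) : max (C x) (C.symm x) = C.symm x :=
  max_eq_right (h.le.trans (C.le_symm_apply.2 h.le))

/-- Order isomorphisms of the line which move every point in the same direction are conjugate,
by a conjugacy fixing their common fixed points. -/
theorem exists_conjugacy {A B : ℝ ≃o ℝ} (hpos : ∀ x, x < A x ↔ x < B x)
    (hneg : ∀ x, A x < x ↔ B x < x) :
    ∃ k : ℝ ≃o ℝ, (∀ x, k (A x) = B (k x)) ∧ ∀ x, A x = x → k x = x := by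
  have hfix : ∀ x, A x = x ↔ B x = x := fun x => by
    have h₁ := hpos x
    have h₂ := hneg x
    grind
  obtain ⟨A', hA'⟩ := exists_orderIso_max_symm A
  obtain ⟨B', hB'⟩ := exists_orderIso_max_symm B
  have hA'fix : ∀ x, A' x = x ↔ A x = x := fun x => by rw [hA', max_symm_eq_self_iff]
  have hB'fix : ∀ x, B' x = x ↔ B x = x := fun x => by rw [hB', max_symm_eq_self_iff]
  obtain ⟨k, hk, hrel⟩ := exists_conjugacy_of_le (A := A') (B := B')
    (fun x => by rw [hA']; exact le_max_symm A x) (fun x => by rw [hB']; exact le_max_symm B x)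
    (fun x => by rw [hA'fix, hB'fix, hfix])
  have hP : {z | A' z = z} = {z | B z = z} := Set.ext fun z => by
    simp only [Set.mem_ofPred_eq, hA'fix, hfix]
  rw [hP] at hrel
  have hkfix : ∀ x, A x = x → k x = x := fun x hx =>
    ((hrel x).resolve_right fun h =>
      Set.disjoint_left.1 h Set.left_mem_uIcc ((hfix x).1 hx)).symm
  have hcont : Continuous fun z => B z - z := B.continuous.sub continuous_id
  have hzero : ∀ x, 0 ∈ Set.uIcc (B x - x) (B (k x) - k x) → B x = x := fun x h0 => by
    obtain ⟨z, hz, hz0⟩ := intermediate_value_uIcc hcont.continuousOn h0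
    have hzB : B z = z := sub_eq_zero.1 hz0
    rcases hrel x with h | h
    · rw [← h, Set.uIcc_self, Set.mem_singleton_iff] at hz
      exact hz ▸ hzB
    · exact absurd hzB (Set.disjoint_left.1 h hz)
  have hkpos : ∀ x, x < B x → k x < B (k x) := fun x hx => by
    by_contra! hc
    exact hx.ne' (hzero x (Set.Icc_subset_uIcc' ⟨by linarith, by linarith⟩))
  have hkneg : ∀ x, B x < x → B (k x) < k x := fun x hx => by
    by_contra! hc
    exact hx.ne (hzero x (Set.Icc_subset_uIcc ⟨by linarith, by linarith⟩))
  refine ⟨k, fun x => ?_, hkfix⟩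
  rcases lt_trichotomy x (A x) with h | h | h
  · rw [← max_symm_of_lt h, ← hA', hk, hB', max_symm_of_lt (hkpos x ((hpos x).1 h))]
  · rw [← h, hkfix x h.symm, (hfix x).1 h.symm]
  · have hy : A (A x) < A x := A.strictMono h
    have := hk (A x)
    rw [hA', max_symm_of_gt hy, A.symm_apply_apply, hB',
      max_symm_of_gt (hkneg _ ((hneg _).1 hy))] at this
    rw [this, B.apply_symm_apply]

/-! ### Square roots of the unit translation from a half-period map -/

/-- The extension, equivariant under the unit translation, of the map of `[p, p + 1)` given by `K`
on `[p, q)` and by `K⁻¹ + 1` on `[q, p + 1)`. -/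
def halfTurn (K : ℝ ≃o ℝ) (p q x : ℝ) : ℝ :=
  (if x - ⌊x - p⌋ < q then K (x - ⌊x - p⌋) else K.symm (x - ⌊x - p⌋) + 1) + ⌊x - p⌋

theorem halfTurn_add_int (K : ℝ ≃o ℝ) (p q x : ℝ) (n : ℤ) :
    halfTurn K p q (x + n) = halfTurn K p q x + n := by
  have h₁ : ⌊x + n - p⌋ = ⌊x - p⌋ + n := by rw [add_sub_right_comm, Int.floor_add_intCast]
  have h₂ : x + n - ((⌊x - p⌋ + n : ℤ) : ℝ) = x - ⌊x - p⌋ := by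
    push_cast
    ring
  rw [halfTurn, halfTurn, h₁, h₂]
  push_cast
  ring

theorem halfTurn_of_lt {K : ℝ ≃o ℝ} {p q x : ℝ} (hq : q ≤ p + 1) (h₁ : p ≤ x) (h₂ : x < q) :
    halfTurn K p q x = K x := by
  have : ⌊x - p⌋ = 0 := Int.floor_eq_zero_iff.2 ⟨by linarith, by linarith⟩
  simp [halfTurn, this, h₂]

theorem halfTurn_of_ge {K : ℝ ≃o ℝ} {p q x : ℝ} (hq : p ≤ q) (h₁ : q ≤ x) (h₂ : x < p + 1) :
    halfTurn K p q x = K.symm x + 1 := by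
  have : ⌊x - p⌋ = 0 := Int.floor_eq_zero_iff.2 ⟨by linarith, by linarith⟩
  simp [halfTurn, this, h₁.not_gt]

theorem exists_eq_add_int_mem_Ico (p x : ℝ) : ∃ z ∈ Set.Ico p (p + 1), ∃ n : ℤ, x = z + n :=
  ⟨x - ⌊x - p⌋, ⟨by linarith [Int.floor_le (x - p)], by linarith [Int.lt_floor_add_one (x - p)]⟩,
    ⌊x - p⌋, by ring⟩

theorem halfTurn_halfTurn {K : ℝ ≃o ℝ} {p q : ℝ} (hpq : p ≤ q) (hqp : q ≤ p + 1) (hp : K p = q)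
    (hq : K q = p + 1) (x : ℝ) : halfTurn K p q (halfTurn K p q x) = x + 1 := by
  obtain ⟨z, ⟨hz₁, hz₂⟩, n, rfl⟩ := exists_eq_add_int_mem_Ico p x
  rw [halfTurn_add_int, halfTurn_add_int, add_right_comm]
  congr 1
  rcases lt_or_ge z q with h | h
  · have h₁ : q ≤ K z := hp ▸ K.monotone hz₁
    have h₂ : K z < p + 1 := hq ▸ K.strictMono h
    rw [halfTurn_of_lt hqp hz₁ h, halfTurn_of_ge hpq h₁ h₂, K.symm_apply_apply]
  · have h₁ : p ≤ K.symm z := K.le_symm_apply.2 (hp.trans_le h)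
    have h₂ : K.symm z < q := K.symm_apply_lt.2 (hq ▸ hz₂)
    have := halfTurn_add_int K p q (K.symm z) 1
    rw [Int.cast_one] at this
    rw [halfTurn_of_ge hpq h hz₂, this, halfTurn_of_lt hqp h₁ h₂, K.apply_symm_apply]

theorem halfTurn_mem_Ico {K : ℝ ≃o ℝ} {p q z : ℝ} (hpq : p ≤ q) (hqp : q ≤ p + 1) (hp : K p = q)
    (hq : K q = p + 1) (hz : z ∈ Set.Ico p (p + 1)) : halfTurn K p q z ∈ Set.Ico q (q + 1) := by
  obtain ⟨hz₁, hz₂⟩ := hz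
  rcases lt_or_ge z q with h | h
  · have h₁ : q ≤ K z := hp ▸ K.monotone hz₁
    have h₂ : K z < p + 1 := hq ▸ K.strictMono h
    rw [halfTurn_of_lt hqp hz₁ h]
    exact ⟨h₁, by linarith⟩
  · have h₁ : p ≤ K.symm z := K.le_symm_apply.2 (hp.trans_le h)
    have h₂ : K.symm z < q := K.symm_apply_lt.2 (hq ▸ hz₂)
    rw [halfTurn_of_ge hpq h hz₂]
    exact ⟨by linarith, by linarith⟩

theorem monotone_halfTurn {K : ℝ ≃o ℝ} {p q : ℝ} (hpq : p ≤ q) (hqp : q ≤ p + 1) (hp : K p = q)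
    (hq : K q = p + 1) : Monotone (halfTurn K p q) := by
  intro x y hxy
  obtain ⟨u, hu, m, rfl⟩ := exists_eq_add_int_mem_Ico p x
  obtain ⟨v, hv, n, rfl⟩ := exists_eq_add_int_mem_Ico p y
  rw [halfTurn_add_int, halfTurn_add_int]
  have hu' := halfTurn_mem_Ico hpq hqp hp hq hu
  have hv' := halfTurn_mem_Ico hpq hqp hp hq hv
  rcases lt_trichotomy m n with h | rfl | h
  · have : (m : ℝ) + 1 ≤ n := by exact_mod_cast h
    linarith [hu'.2, hv'.1]
  · have huv : u ≤ v := by linarith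
    refine add_le_add_left ?_ _
    rcases lt_or_ge u q with h₁ | h₁ <;> rcases lt_or_ge v q with h₂ | h₂
    · rw [halfTurn_of_lt hqp hu.1 h₁, halfTurn_of_lt hqp hv.1 h₂]
      exact K.monotone huv
    · have h₃ : K u < p + 1 := hq ▸ K.strictMono h₁
      have h₄ : p ≤ K.symm v := K.le_symm_apply.2 (hp.trans_le h₂)
      rw [halfTurn_of_lt hqp hu.1 h₁, halfTurn_of_ge hpq h₂ hv.2]
      linarith
    · linarith
    · rw [halfTurn_of_ge hpq h₁ hu.2, halfTurn_of_ge hpq h₂ hv.2]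
      linarith [K.symm.monotone huv]
  · have : (n : ℝ) + 1 ≤ m := by exact_mod_cast h
    linarith [hu.1, hv.2]

theorem symm_add_int {F : ℝ ≃o ℝ} (hF : ∀ (x : ℝ) (n : ℤ), F (x + n) = F x + n) (x : ℝ) (n : ℤ) :
    F.symm (x + n) = F.symm x + n := by
  rw [F.symm_apply_eq, hF, F.apply_symm_apply]

theorem halfTurn_semiconj {K F : ℝ ≃o ℝ} {p q : ℝ} (hpq : p ≤ q) (hqp : q ≤ p + 1)
    (hF : ∀ (x : ℝ) (n : ℤ), F (x + n) = F x + n) (hFp : F p = p) (hFq : F q = q)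
    (hK : ∀ x, K (F x) = F.symm (K x)) (x : ℝ) :
    halfTurn K p q (F x) = F.symm (halfTurn K p q x) := by
  obtain ⟨z, ⟨hz₁, hz₂⟩, n, rfl⟩ := exists_eq_add_int_mem_Ico p x
  rw [hF, halfTurn_add_int, halfTurn_add_int, symm_add_int hF]
  congr 1
  have hFp1 : F (p + 1) = p + 1 := by simpa [hFp] using hF p 1
  have hFp : p ≤ F z := hFp ▸ F.monotone hz₁
  have hFp1 : F z < p + 1 := hFp1 ▸ F.strictMono hz₂
  rcases lt_or_ge z q with h | h
  · have h₁ : F z < q := hFq ▸ F.strictMono h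
    rw [halfTurn_of_lt hqp hz₁ h, halfTurn_of_lt hqp hFp h₁, hK]
  · have h₁ : q ≤ F z := hFq ▸ F.monotone h
    have h₂ := symm_add_int hF (K.symm z) 1
    have h₃ := hK (F.symm (K.symm z))
    rw [F.apply_symm_apply, K.apply_symm_apply, F.eq_symm_apply] at h₃
    rw [Int.cast_one] at h₂
    rw [halfTurn_of_ge hpq h hz₂, halfTurn_of_ge hpq h₁ hFp1, h₂, h₃, K.symm_apply_apply]

/-- If `H` reverses the direction of motion of `F` and has an orbit of period two modulo integers
through a fixed point of `F`, then a square root of the unit translation conjugates `F` to its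
inverse. -/
theorem exists_sqrt_translation_conj_inv {F H : ℝ ≃o ℝ} {p : ℝ}
    (hF : ∀ (x : ℝ) (n : ℤ), F (x + n) = F x + n) (hH : ∀ (x : ℝ) (n : ℤ), H (x + n) = H x + n)
    (hpos : ∀ x, x < F x ↔ F (H x) < H x) (hneg : ∀ x, F x < x ↔ H x < F (H x))
    (hFp : F p = p) (hHp : H (H p) = p + 1) :
    ∃ S : CircleDeg1Lift, (∀ x, S (S x) = x + 1) ∧ ∀ x, S (F x) = F.symm (S x) := by
  have hfix : ∀ x, F x = x → F (H x) = H x := fun x hx => by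
    have h₁ := hpos x
    have h₂ := hneg x
    grind
  have hH1 : ∀ x, H (x + 1) = H x + 1 := fun x => by simpa using hH x 1
  have hpq : p ≤ H p := by
    by_contra! hc
    linarith [H.strictMono hc]
  have hqp : H p ≤ p + 1 := by
    by_contra! hc
    have := H.strictMono hc
    rw [hH1] at this
    linarith
  obtain ⟨k, hk, hkfix⟩ := exists_conjugacy (A := (H.symm.trans F).trans H) (B := F.symm)
    (fun x => by
      have h := hpos (H.symm x)
      rw [H.apply_symm_apply] at h
      rw [F.lt_symm_apply, ← h, OrderIso.trans_apply, OrderIso.trans_apply, ← H.symm_apply_lt])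
    (fun x => by
      have h := hneg (H.symm x)
      rw [H.apply_symm_apply] at h
      rw [F.symm_apply_lt, ← h, OrderIso.trans_apply, OrderIso.trans_apply, ← H.lt_symm_apply])
  have hkfix' : ∀ x, F x = x → k (H x) = H x := fun x hx => hkfix _ (by simp [hx])
  have hKp : (H.trans k) p = H p := hkfix' p hFp
  have hKq : (H.trans k) (H p) = p + 1 := (hkfix' _ (hfix p hFp)).trans hHp
  refine ⟨⟨⟨halfTurn (H.trans k) p (H p), monotone_halfTurn hpq hqp hKp hKq⟩, fun x => ?_⟩,
    halfTurn_halfTurn hpq hqp hKp hKq,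
    halfTurn_semiconj hpq hqp hF hFp (hfix p hFp) fun x => ?_⟩
  · simpa using halfTurn_add_int (H.trans k) p (H p) x 1
  · simpa using hk (H x)

/-- A map reversing the direction of motion of `F` whose square has a fixed point modulo the unit
translation also has one which is fixed by `F`. -/
theorem exists_fixed_half_periodic {F H : ℝ ≃o ℝ} (hF : ∀ (x : ℝ) (n : ℤ), F (x + n) = F x + n)
    (hfix : ∀ x, F x = x ↔ F (H x) = H x)
    (hFfix : ∃ x, F x = x) (hHper : ∃ x, H (H x) = x + 1) :
    ∃ p, F p = p ∧ H (H p) = p + 1 := by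
  obtain ⟨y, hy⟩ := hFfix
  obtain ⟨x, hx⟩ := hHper
  set P : Set ℝ := {z | F z = z ∧ z ≤ x}
  have hclosed : IsClosed P :=
    (isClosed_eq F.continuous continuous_id).inter isClosed_Iic
  have hne : P.Nonempty := by
    refine ⟨y + (-⌈y - x⌉ : ℤ), by rw [hF, hy], ?_⟩
    push_cast
    linarith [Int.le_ceil (y - x)]
  have hbdd : BddAbove P := ⟨x, fun z hz => hz.2⟩
  have hp : sSup P ∈ P := hclosed.csSup_mem hne hbdd
  have hmax : ∀ z, F z = z → z ≤ x → z ≤ sSup P := fun z h₁ h₂ => le_csSup hbdd ⟨h₁, h₂⟩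
  refine ⟨sSup P, hp.1, le_antisymm ?_ ?_⟩
  · have h₁ : F (H (H (sSup P))) = H (H (sSup P)) := (hfix _).1 ((hfix _).1 hp.1)
    have h₂ : H (H (sSup P)) ≤ x + 1 := hx ▸ H.monotone (H.monotone hp.2)
    have := hmax (H (H (sSup P)) + (-1 : ℤ)) (by rw [hF, h₁]) (by push_cast; linarith)
    push_cast at this
    linarith
  · have h₁ : F (H.symm (H.symm (sSup P + (1 : ℤ)))) = H.symm (H.symm (sSup P + (1 : ℤ))) := by
      rw [hfix, H.apply_symm_apply, hfix, H.apply_symm_apply, hF, hp.1]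
    have h₂ : H.symm (H.symm (sSup P + (1 : ℤ))) ≤ x := by
      rw [H.symm_apply_le, H.symm_apply_le, hx]
      push_cast
      linarith [hp.2]
    have := hmax _ h₁ h₂
    rw [H.symm_apply_le, H.symm_apply_le] at this
    exact_mod_cast this

/-! ### Lifts of circle homeomorphisms -/

theorem S1.coe_eq_coe_iff {x y : ℝ} : (x : S1) = (y : S1) ↔ ∃ n : ℤ, x = y + n := by
  rw [← sub_eq_zero, ← AddCircle.coe_sub, AddCircle.coe_eq_zero_iff]
  refine exists_congr fun n => ?_
  rw [zsmul_one, eq_comm, sub_eq_iff_eq_add']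

theorem S1.coe_add_int (x : ℝ) (n : ℤ) : ((x + n : ℝ) : S1) = (x : S1) :=
  S1.coe_eq_coe_iff.2 ⟨n, rfl⟩

theorem IsLiftOf.exists_orderIso {f : S1 ≃ₜ S1} {F : CircleDeg1Lift} (hF : IsLiftOf f F) :
    ∃ e : ℝ ≃o ℝ, ∀ x, e x = F x := by
  have hinj : Function.Injective F := fun x y hxy => by
    have : f x = f y := by rw [hF, hF, hxy]
    obtain ⟨n, rfl⟩ := S1.coe_eq_coe_iff.1 (f.injective this)
    rw [F.map_add_int] at hxy
    linarith
  have hsurj : Function.Surjective F := fun y => by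
    obtain ⟨x, hx⟩ := f.surjective (y : S1)
    obtain ⟨x, rfl⟩ := QuotientAddGroup.mk_surjective x
    obtain ⟨n, hn⟩ := S1.coe_eq_coe_iff.1 ((hF x).symm.trans hx)
    exact ⟨x - n, by rw [F.map_sub_int, hn, add_sub_cancel_right]⟩
  exact ⟨(F.strictMono_iff_injective.2 hinj).orderIsoOfSurjective _ hsurj, fun x => rfl⟩

theorem IsLiftOf.mul {f g : S1 ≃ₜ S1} {F G : CircleDeg1Lift} (hF : IsLiftOf f F)
    (hG : IsLiftOf g G) : IsLiftOf (g.trans f) (F * G) := fun x => by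
  rw [Homeomorph.trans_apply, hG, hF, CircleDeg1Lift.mul_apply]

theorem IsLiftOf.exists_add_int {f : S1 ≃ₜ S1} {F : CircleDeg1Lift} (hF : IsLiftOf f F) (j : ℤ) :
    ∃ G : CircleDeg1Lift, IsLiftOf f G ∧ ∀ x, G x = F x + j := by
  have h : ∀ x, (↑(CircleDeg1Lift.translate (Multiplicative.ofAdd (j : ℝ))) * F : CircleDeg1Lift) x
      = F x + j := fun x => by
    rw [CircleDeg1Lift.mul_apply, CircleDeg1Lift.translate_apply, add_comm]
  exact ⟨_, fun x => by rw [h, S1.coe_add_int, hF], h⟩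

theorem exists_eq_add_int_of_coe_eq {G : CircleDeg1Lift} (hG : ∀ x : ℝ, ((G x : ℝ) : S1) = x) :
    ∃ m : ℤ, ∀ x, G x = x + m := by
  choose n hn using fun x => S1.coe_eq_coe_iff.1 (hG x)
  refine ⟨n 0, fun x => ?_⟩
  have h₀ := G.monotone (Int.fract_nonneg x)
  have h₁ := G.monotone (Int.fract_lt_one x).le
  have h₂ : G 1 = G 0 + 1 := by simpa using G.map_add_one 0
  rw [h₂] at h₁
  rw [hn 0, hn (Int.fract x)] at h₀ h₁
  have h₃ : n 0 ≤ n (Int.fract x) := by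
    have : (n 0 : ℝ) < n (Int.fract x) + 1 := by linarith [Int.fract_lt_one x]
    exact Int.lt_add_one_iff.1 (by exact_mod_cast this)
  have h₄ : n (Int.fract x) = n 0 := by
    by_contra hne
    have h₅ : (n 0 : ℝ) + 1 ≤ n (Int.fract x) := by
      exact_mod_cast lt_of_le_of_ne h₃ (Ne.symm hne)
    have : Int.fract x = 0 := le_antisymm (by linarith) (Int.fract_nonneg x)
    exact hne (congrArg n this)
  have := hn (Int.fract x)
  rw [h₄, Int.fract, G.map_sub_int] at this
  linarith

theorem IsInvolution.exists_lift {g : S1 ≃ₜ S1} {G : CircleDeg1Lift} (hg : IsInvolution g)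
    (hG : IsLiftOf g G) :
    (∀ x, g x = x) ∨ ∃ G' : CircleDeg1Lift, IsLiftOf g G' ∧ ∀ x, G' (G' x) = x + 1 := by
  obtain ⟨m, hm⟩ := exists_eq_add_int_of_coe_eq (G := G * G) fun x => by
    rw [CircleDeg1Lift.mul_apply, ← hG, ← hG, hg]
  simp only [CircleDeg1Lift.mul_apply] at hm
  rcases Int.even_or_odd' m with ⟨j, hj | hj⟩ <;> obtain ⟨G', hG', hGj⟩ := hG.exists_add_int (-j)
  · have hsq : ∀ x, G' (G' x) = x := fun x => by
      rw [hGj, hGj, G.map_add_int, hm, hj]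
      push_cast
      ring
    have hid : ∀ x, G' x = x := fun x => by
      rcases lt_trichotomy (G' x) x with h | h | h
      · linarith [G'.monotone h.le, hsq x]
      · exact h
      · linarith [G'.monotone h.le, hsq x]
    left
    rintro ⟨x⟩
    exact (hG' x).trans (by rw [hid]; rfl)
  · refine Or.inr ⟨G', hG', fun x => ?_⟩
    rw [hGj, hGj, G.map_add_int, hm, hj]
    push_cast
    ring

theorem signature_coe (F : CircleDeg1Lift) (x : ℝ) : signature F x = Real.sign (F x - x) := by
  obtain ⟨n, hn⟩ : ∃ n : ℤ, rep x = x + n :=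
    S1.coe_eq_coe_iff.1 (AddCircle.coe_equivIco (p := (1 : ℝ)) (a := 0) (y := (x : S1)))
  rw [signature, hn, F.map_add_int, add_sub_add_right_eq_sub]

theorem Real.sign_eq_neg_sign_iff {a b : ℝ} :
    Real.sign a = -Real.sign b ↔ (0 < a ↔ b < 0) ∧ (a < 0 ↔ 0 < b) := by
  unfold Real.sign
  grind

theorem signature_eq_neg_iff {F H : CircleDeg1Lift} {h : S1 ≃ₜ S1} (hH : IsLiftOf h H) :
    (∀ y, signature F y = -signature F (h y)) ↔
      ∀ x, (x < F x ↔ F (H x) < H x) ∧ (F x < x ↔ H x < F (H x)) := by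
  have : (∀ y, signature F y = -signature F (h y)) ↔
      ∀ x : ℝ, signature F x = -signature F (h x) :=
    ⟨fun h x => h x, by rintro h ⟨x⟩; exact h x⟩
  rw [this]
  refine forall_congr' fun x => ?_
  rw [hH, signature_coe, signature_coe, Real.sign_eq_neg_sign_iff]
  simp only [sub_pos, sub_neg]

theorem StronglyReversiblePlus.isInvolution_or {f : S1 ≃ₜ S1} (hf : OrientationPreserving f)
    (h : StronglyReversiblePlus f) :
    IsInvolution f ∨
      ∃ (F : CircleDeg1Lift) (h : S1 ≃ₜ S1), IsLiftOf f F ∧ (∃ x : ℝ, F x = x) ∧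
        OrientationPreserving h ∧ HasRotationNumber h (1 / 2) ∧
        ∀ y : S1, signature F y = -signature F (h y) := by
  obtain ⟨σ, ⟨S₀, hS₀⟩, hσ, hconj⟩ := h
  obtain ⟨F₀, hF₀⟩ := hf
  rcases hσ.exists_lift hS₀ with hid | ⟨S, hS, hSS⟩
  · left
    intro x
    have := hconj (f x)
    rwa [hid, hid, f.symm_apply_apply] at this
  have hg : IsInvolution (σ.trans f) := fun x => by
    simp only [Homeomorph.trans_apply, hconj, f.apply_symm_apply]
  rcases hg.exists_lift (hF₀.mul hS) with hid | ⟨G, hG, hGG⟩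
  · left
    have hfσ : ∀ x, f x = σ x := fun x => by
      have := hid (σ x)
      rwa [Homeomorph.trans_apply, hσ] at this
    intro x
    rw [hfσ, hfσ, hσ]
  right
  have hσσ : (σ.trans (σ.trans f)) = f := by
    ext x
    simp only [Homeomorph.trans_apply, hσ x]
  obtain ⟨F, hF, hFG⟩ := (hG.mul hS).exists_add_int (-1)
  rw [hσσ] at hF
  obtain ⟨e, he⟩ := hF.exists_orderIso
  obtain ⟨g, hg⟩ := hG.exists_orderIso
  have hF₁ : ∀ x, F x = G (S x) - 1 := fun x => by
    rw [hFG, CircleDeg1Lift.mul_apply]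
    push_cast
    ring
  have hF₂ : ∀ x, F (S x) = G x := fun x => by
    rw [hF₁, hSS, G.map_add_one, add_sub_cancel_right]
  have hGlt : ∀ x y, G x < G y ↔ x < y := fun x y => by rw [← hg, ← hg, g.lt_iff_lt]
  have hflip : ∀ x, (x < F x ↔ F (S x) < S x) ∧ (F x < x ↔ S x < F (S x)) := fun x => by
    rw [hF₁ x, hF₂, lt_sub_iff_add_lt, sub_lt_iff_lt_add, ← hGG, hGlt, hGlt]
    exact ⟨Iff.rfl, Iff.rfl⟩
  have hcont : Continuous fun x => F x - x := by
    have : (fun x => F x - x) = fun x => e x - x := by simp only [he]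
    rw [this]
    exact e.continuous.sub continuous_id
  have hfix : ∃ x, F x - x = 0 := by
    have h₁ := (hflip 0).1
    have h₂ := (hflip 0).2
    refine mem_range_of_exists_le_of_exists_ge hcont ?_ ?_
    · by_contra! hc
      linarith [h₁.1 (sub_pos.1 (hc 0)), hc (S 0)]
    · by_contra! hc
      linarith [h₂.1 (sub_neg.1 (hc 0)), hc (S 0)]
  refine ⟨F, σ, hF, hfix.imp fun x => sub_eq_zero.1, ⟨S, hS⟩, ⟨S, hS, ?_⟩,
    (signature_eq_neg_iff hS).2 hflip⟩
  have := S.translationNumber_of_map_pow_eq_add_int (x := 0) (n := 2) (m := 1)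
    (by rw [pow_two, CircleDeg1Lift.mul_apply, hSS, Int.cast_one]) two_pos
  simpa using this

theorem exists_homeomorph_of_sqrt_translation {S : CircleDeg1Lift} (hSS : ∀ x, S (S x) = x + 1) :
    ∃ σ : S1 ≃ₜ S1, IsLiftOf σ S ∧ IsInvolution σ := by
  have hinj : Function.Injective S := fun x y hxy => by
    have := congrArg S hxy
    rw [hSS, hSS] at this
    linarith
  have hsurj : Function.Surjective S := fun y =>
    ⟨S (y - 1), by rw [hSS, sub_add_cancel]⟩
  have hcont : Continuous S :=
    ((S.strictMono_iff_injective.2 hinj).orderIsoOfSurjective _ hsurj).continuous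
  have hper : Function.Periodic (fun x => ((S x : ℝ) : S1)) 1 := fun x => by
    simp only [S.map_add_one, AddCircle.coe_add_period]
  have hlift : ∀ x : ℝ, hper.lift (x : S1) = ((S x : ℝ) : S1) := hper.lift_coe
  have hinv : Function.Involutive hper.lift := by
    rintro ⟨x⟩
    refine (congrArg _ (hlift x)).trans ((hlift _).trans ?_)
    rw [hSS]
    exact AddCircle.coe_add_period 1 x
  have hcont' : Continuous hper.lift :=
    continuous_coinduced_dom.2 ((AddCircle.continuous_mk' 1).comp hcont)
  exact ⟨⟨hinv.toPerm, hcont', hcont'⟩, hlift, hinv⟩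

theorem stronglyReversiblePlus_of_signature {f h : S1 ≃ₜ S1} {F : CircleDeg1Lift}
    (hF : IsLiftOf f F) (hfix : ∃ x, F x = x) (hrot : HasRotationNumber h (1 / 2))
    (hsig : ∀ y, signature F y = -signature F (h y)) : StronglyReversiblePlus f := by
  obtain ⟨H, hH, hτ⟩ := hrot
  obtain ⟨e, he⟩ := hF.exists_orderIso
  obtain ⟨k, hk⟩ := hH.exists_orderIso
  have hcont : Continuous H := by
    have : ⇑H = k := funext fun x => (hk x).symm
    rw [this]
    exact k.continuous
  obtain ⟨x, hx⟩ := (H.translationNumber_eq_rat_iff hcont (m := 1) two_pos).1 (by simpa using hτ)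
  rw [pow_two, CircleDeg1Lift.mul_apply, Int.cast_one] at hx
  rw [signature_eq_neg_iff hH] at hsig
  have heint : ∀ (x : ℝ) (n : ℤ), e (x + n) = e x + n := fun x n => by
    rw [he, he, F.map_add_int]
  have hkint : ∀ (x : ℝ) (n : ℤ), k (x + n) = k x + n := fun x n => by
    rw [hk, hk, H.map_add_int]
  simp only [← he, ← hk] at hsig hx hfix
  obtain ⟨p, hp, hkp⟩ := exists_fixed_half_periodic heint
    (fun x => by
      have := hsig x
      grind) hfix ⟨x, hx⟩
  obtain ⟨S, hSS, hSe⟩ := exists_sqrt_translation_conj_inv heint hkint (fun x => (hsig x).1)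
    (fun x => (hsig x).2) hp hkp
  obtain ⟨σ, hσ, hinv⟩ := exists_homeomorph_of_sqrt_translation hSS
  refine ⟨σ, ⟨S, hσ⟩, hinv, ?_⟩
  rintro ⟨x⟩
  change σ (f (σ (x : S1))) = f.symm (x : S1)
  rw [f.eq_symm_apply, hσ, hF, hσ, ← he, hSe, hSS, hF, ← he, e.apply_symm_apply]
  exact AddCircle.coe_add_period 1 x

/-- An orientation preserving circle homeomorphism is strongly reversible in
`Homeo⁺(S¹)` iff it is an involution, or it has a fixed point (equivalently, a lift `F`
with a fixed point) and there is an orientation preserving `h` of rotation number `1/2`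
with `Δ_f = -Δ_f ∘ h`. -/
theorem stmt12 (f : S1 ≃ₜ S1) (hf : OrientationPreserving f) :
    StronglyReversiblePlus f ↔
      (IsInvolution f ∨
        ∃ (F : CircleDeg1Lift) (h : S1 ≃ₜ S1), IsLiftOf f F ∧ (∃ x : ℝ, F x = x) ∧
          OrientationPreserving h ∧ HasRotationNumber h (1 / 2) ∧
          ∀ y : S1, signature F y = -signature F (h y)) := by
  refine ⟨fun h => h.isInvolution_or hf, ?_⟩
  rintro (h | ⟨F, h, hF, hfix, -, hrot, hsig⟩)
  · exact ⟨Homeomorph.refl _, ⟨1, fun x => rfl⟩, fun x => rfl,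
      fun x => f.eq_symm_apply.2 (h x)⟩
  · exact stronglyReversiblePlus_of_signature hF hfix hrot hsig
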